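/- Let 𝒳 ∈ ℝ^{n1×n2×n3}, let p, q be positive integers with pq = n1n2, and let 𝒳̃ ∈ ℝ^{n3×p×q} be the tensor obtained by reshaping the mode-3 unfolding X_{(3)}, i.e., 𝒳̃(a, s, t) = X_{(3)}(a, (t−1)p + s). Let 𝒳_{(13)} ∈ ℝ^{n1×n3×n2} be the permuted tensor with 𝒳_{(13)}(i, k, j) = 𝒳(i, j, k). Then rank_t(𝒳̃) ≤ n2 · rank_t(𝒳_{(13)}) and rank_t(𝒳_{(13)}) ≤ q · rank_t(𝒳̃). -/

import Mathlib

/-- The `k`-th Fourier slice of a third order real tensor `A ∈ ℝ^{n1×n2×n3}`: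
`Ā^{(k)}_{ij} = Σ_{l=1}^{n3} ω^{(l−1)(k−1)} A_{ijl}` with `ω = exp(−2π i / n3)`
(0-indexed here, so the exponent is `l·k`). -/
noncomputable def fourierSlice {n1 n2 n3 : ℕ} (A : Fin n1 → Fin n2 → Fin n3 → ℝ)
    (k : Fin n3) : Matrix (Fin n1) (Fin n2) ℂ :=
  Matrix.of fun i j =>
    ∑ l : Fin n3,
      Complex.exp (-(2 * (Real.pi : ℂ) * Complex.I) / (n3 : ℂ)) ^ ((l : ℕ) * (k : ℕ)) *
        (A i j l : ℂ)

/-- The tubal rank of a third order real tensor: `rank_t(A) = max_k rank(Ā^{(k)})`. -/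
noncomputable def tubalRank {n1 n2 n3 : ℕ} (A : Fin n1 → Fin n2 → Fin n3 → ℝ) : ℕ :=
  Finset.univ.sup fun k : Fin n3 => (fourierSlice A k).rank

/-- The column index `j + (k−1)·a` (1-indexed), i.e. `k·a + j` (0-indexed). -/
def colIdx {a b : ℕ} (j : Fin a) (k : Fin b) : Fin (a * b) :=
  ⟨(k : ℕ) * a + (j : ℕ), by
    have hj := j.isLt
    have hk : (k : ℕ) + 1 ≤ b := k.isLt
    have h1 : ((k : ℕ) + 1) * a ≤ b * a := Nat.mul_le_mul_right _ hk
    have h2 : ((k : ℕ) + 1) * a = (k : ℕ) * a + a := Nat.succ_mul _ _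
    have h3 : b * a = a * b := Nat.mul_comm _ _
    omega⟩

/-- The horizontal concatenation of the frontal slices of a third order real tensor, as a complex
matrix. -/
def concatSlices {n1 n2 n3 : ℕ} (A : Fin n1 → Fin n2 → Fin n3 → ℝ) :
    Matrix (Fin n1) (Fin n2 × Fin n3) ℂ :=
  Matrix.of fun i x => (A i x.1 x.2 : ℂ)

/-- `colIdx` as a bijection between index pairs and column indices. -/
def colIdxEquiv (a b : ℕ) : Fin a × Fin b ≃ Fin (a * b) :=
  ((Equiv.prodComm _ _).trans finProdFinEquiv).trans (finCongr (mul_comm b a))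

theorem colIdxEquiv_apply {a b : ℕ} (x : Fin a × Fin b) :
    colIdxEquiv a b x = colIdx x.1 x.2 := by
  ext
  simp [colIdxEquiv, colIdx]
  ring

theorem Matrix.rank_add_le {m n K : Type*} [Fintype n] [Finite m] [Field K]
    (A B : Matrix m n K) : (A + B).rank ≤ A.rank + B.rank := by
  rw [Matrix.rank, Matrix.mulVecLin_add]
  exact (Submodule.finrank_mono (LinearMap.range_add_le _ _)).trans
    (Submodule.finrank_add_le_finrank_add_finrank _ _)

theorem Matrix.rank_sum_le {ι m n K : Type*} [Fintype n] [Finite m] [Field K]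
    (s : Finset ι) (A : ι → Matrix m n K) :
    (∑ i ∈ s, A i).rank ≤ ∑ i ∈ s, (A i).rank := by
  classical
  induction s using Finset.induction_on with
  | empty => simp
  | insert i s hi ih =>
    rw [Finset.sum_insert hi, Finset.sum_insert hi]
    exact (Matrix.rank_add_le _ _).trans (by gcongr)

theorem tubalRank_swap {n1 n2 n3 : ℕ} (A : Fin n1 → Fin n2 → Fin n3 → ℝ) :
    tubalRank (fun j i l => A i j l) = tubalRank A := by
  unfold tubalRank
  congr 1
  funext k
  rw [← Matrix.rank_transpose]
  rfl

theorem tubalRank_le_rank_concatSlices {n1 n2 n3 : ℕ} (A : Fin n1 → Fin n2 → Fin n3 → ℝ) :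
    tubalRank A ≤ (concatSlices A).rank := by
  refine Finset.sup_le fun k _ => ?_
  have h : fourierSlice A k = concatSlices A * (Matrix.of fun x j => if x.1 = j then
      Complex.exp (-(2 * (Real.pi : ℂ) * Complex.I) / (n3 : ℂ)) ^ ((x.2 : ℕ) * (k : ℕ))
      else 0 : Matrix (Fin n2 × Fin n3) (Fin n2) ℂ) := by
    ext i j
    simp [fourierSlice, concatSlices, Matrix.mul_apply, Fintype.sum_prod_type_right, mul_comm]
  rw [h]
  exact Matrix.rank_mul_le_left _ _

theorem exp_pow_injective (n : ℕ) : Function.Injective fun l : Fin n =>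
    Complex.exp (-(2 * (Real.pi : ℂ) * Complex.I) / (n : ℂ)) ^ (l : ℕ) := by
  intro a b h
  have hn : n ≠ 0 := fun h0 => by subst h0; exact a.elim0
  have hω : IsPrimitiveRoot (Complex.exp (-(2 * (Real.pi : ℂ) * Complex.I) / (n : ℂ))) n := by
    rw [neg_div, Complex.exp_neg]
    exact (Complex.isPrimitiveRoot_exp n hn).inv
  exact Fin.ext (hω.pow_inj a.isLt b.isLt h)

theorem rank_concatSlices_le {n1 n2 n3 : ℕ} (A : Fin n1 → Fin n2 → Fin n3 → ℝ) :
    (concatSlices A).rank ≤ n3 * tubalRank A := by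
  set V : Matrix (Fin n3) (Fin n3) ℂ := Matrix.vandermonde fun l : Fin n3 =>
    Complex.exp (-(2 * (Real.pi : ℂ) * Complex.I) / (n3 : ℂ)) ^ (l : ℕ) with hVdef
  have hV : V * V⁻¹ = 1 := Matrix.mul_nonsing_inv _
    (isUnit_iff_ne_zero.mpr (Matrix.det_vandermonde_ne_zero_iff.mpr (exp_pow_injective n3)))
  have hslice (i : Fin n1) (j : Fin n2) (k : Fin n3) :
      fourierSlice A k i j = ∑ l, (A i j l : ℂ) * V l k := by
    simp only [fourierSlice, hVdef, Matrix.of_apply, Matrix.vandermonde_apply, pow_mul]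
    exact Finset.sum_congr rfl fun _ _ => mul_comm _ _
  have h : concatSlices A = ∑ k, fourierSlice A k * (Matrix.of fun j x =>
      if j = x.1 then V⁻¹ k x.2 else 0 : Matrix (Fin n2) (Fin n2 × Fin n3) ℂ) := by
    ext i ⟨j, l⟩
    have hinv := congrFun (Matrix.vecMul_one fun l => (A i j l : ℂ)) l
    rw [← hV, ← Matrix.vecMul_vecMul] at hinv
    simp only [Matrix.vecMul, dotProduct] at hinv
    simp [concatSlices, Matrix.sum_apply, Matrix.mul_apply, hslice, ← hinv]
  rw [h]
  refine (Matrix.rank_sum_le _ _).trans ?_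
  calc _ ≤ ∑ _k : Fin n3, tubalRank A := Finset.sum_le_sum fun k _ =>
        (Matrix.rank_mul_le_left _ _).trans
          (Finset.le_sup (f := fun k => (fourierSlice A k).rank) (Finset.mem_univ k))
    _ = n3 * tubalRank A := by simp

/-- with `X_{(3)} ∈ ℝ^{n3×n1n2}` the mode-3 unfolding of
`𝒳 ∈ ℝ^{n1×n2×n3}`, `pq = n1n2`, `𝒳̃ ∈ ℝ^{n3×p×q}` the reshape of `X_{(3)}`
(`𝒳̃(a,s,t) = X_{(3)}(a, (t−1)p + s)`), and `𝒳_{(13)} ∈ ℝ^{n1×n3×n2}` the permuted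
tensor (`𝒳_{(13)}(i,k,j) = 𝒳(i,j,k)`), one has
`rank_t(𝒳̃) ≤ n2 · rank_t(𝒳_{(13)})` and `rank_t(𝒳_{(13)}) ≤ q · rank_t(𝒳̃)`. -/
theorem tubalRank_tilde_perm13_bounds (n1 n2 n3 p q : ℕ)
    (hp : 0 < p) (hq : 0 < q) (hpq : p * q = n1 * n2)
    (T : Fin n1 → Fin n2 → Fin n3 → ℝ)
    (X3 : Matrix (Fin n3) (Fin (n1 * n2)) ℝ)
    (hX3 : ∀ (i1 : Fin n1) (i2 : Fin n2) (i3 : Fin n3),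
      X3 i3 (colIdx i1 i2) = T i1 i2 i3)
    (Ttil : Fin n3 → Fin p → Fin q → ℝ)
    (hTtil : ∀ (a : Fin n3) (s : Fin p) (t : Fin q),
      Ttil a s t = X3 a (Fin.cast hpq (colIdx s t)))
    (T13 : Fin n1 → Fin n3 → Fin n2 → ℝ)
    (hT13 : ∀ (i : Fin n1) (j : Fin n2) (k : Fin n3), T13 i k j = T i j k) :
    tubalRank Ttil ≤ n2 * tubalRank T13 ∧ tubalRank T13 ≤ q * tubalRank Ttil := by
  have htil : concatSlices Ttil = (X3.map Complex.ofReal).submatrix (Equiv.refl _)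
      ((colIdxEquiv p q).trans (finCongr hpq)) := by
    ext a x
    simp [concatSlices, hTtil, colIdxEquiv_apply]
  have h13 : concatSlices (fun k i j => T13 i k j) =
      (X3.map Complex.ofReal).submatrix (Equiv.refl _) (colIdxEquiv n1 n2) := by
    ext a x
    simp [concatSlices, hT13, hX3, colIdxEquiv_apply]
  have hrank : (concatSlices Ttil).rank = (concatSlices fun k i j => T13 i k j).rank := by
    rw [htil, h13, Matrix.rank_submatrix, Matrix.rank_submatrix]
  rw [← tubalRank_swap T13]
  exact ⟨(tubalRank_le_rank_concatSlices _).trans (hrank.trans_le (rank_concatSlices_le _)),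
    (tubalRank_le_rank_concatSlices _).trans (hrank.symm.trans_le (rank_concatSlices_le _))⟩
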